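/- Let R be a commutative ring, let m_1, m_2 ≥ 1, set n = m_1 + m_2, and let Y_1,…,Y_n ∈ R. Let U' be the n×n block-diagonal matrix diag(U_{m_1}, U_{m_2}), where U_m = U_m(Y_1,…,Y_m) is the m×m lower-triangular Toeplitz matrix with (i,j) entry Y_{i−j+1} when i ≥ j and 0 otherwise. Let N' be an n×n matrix over R such that the product of any two entries of N' is zero, and write N_{11} for its top-left m_1×m_1 block and N_{22} for its bottom-right m_2×m_2 block. Then det(U' + N') = Y_1^n + Σ_{k=1}^{n} (Tr_{k−1} N_{11} + Tr_{k−1} N_{22}) · C_{1,k}(U_n), where U_n = U_n(Y_1,…,Y_n) is the full n×n lower-triangular Toeplitz matrix, Tr_m of a square matrix is the sum of the entries on its m-th superdiagonal (zero when m is at least the size of the matrix), and C_{1,k}(U_n) is the (1,k) cofactor of U_n. -/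

import Mathlib

/-- The `n × n` lower-triangular Toeplitz matrix with `(i,j)` entry `Y (i - j + 1)`
(one-based value index) when `i ≥ j` and `0` otherwise; here `Y m` denotes `Y_m`. -/
def lowerToeplitz {R : Type*} [CommRing R] (n : ℕ) (Y : ℕ → R) :
    Matrix (Fin n) (Fin n) R :=
  Matrix.of fun i j => if (j : ℕ) ≤ (i : ℕ) then Y ((i : ℕ) - (j : ℕ) + 1) else 0

/-- `Tr_m N`: the sum of the entries on the `m`-th superdiagonal of `N`
(`Tr_0` is the trace; `Tr_m N = 0` for `m ≥ s`). -/
def trSuper {R : Type*} [CommRing R] {s : ℕ} (N : Matrix (Fin s) (Fin s) R) (m : ℕ) : R :=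
  ∑ i : Fin s, if h : (i : ℕ) + m < s then N i ⟨(i : ℕ) + m, h⟩ else 0

theorem Finset.prod_add_of_mul_eq_zero {ι R : Type*} [DecidableEq ι] [CommRing R]
    (s : Finset ι) (a b : ι → R) (hb : ∀ i j, b i * b j = 0) :
    ∏ i ∈ s, (a i + b i) = ∏ i ∈ s, a i + ∑ i ∈ s, b i * ∏ j ∈ s.erase i, a j := by
  induction s using Finset.induction_on with
  | empty => simp
  | insert x s hx ih =>
    have h0 : b x * ∑ i ∈ s, b i * ∏ j ∈ s.erase i, a j = 0 := by
      rw [Finset.mul_sum]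
      exact Finset.sum_eq_zero fun i _ => by rw [← mul_assoc, hb, zero_mul]
    have h1 : ∑ i ∈ s, b i * ∏ j ∈ (insert x s).erase i, a j
        = a x * ∑ i ∈ s, b i * ∏ j ∈ s.erase i, a j := by
      rw [Finset.mul_sum]
      refine Finset.sum_congr rfl fun i hi => ?_
      have hne : x ≠ i := fun h => hx (h ▸ hi)
      rw [Finset.erase_insert_of_ne hne, Finset.prod_insert (by simp [hx])]
      ring
    rw [Finset.prod_insert hx, Finset.prod_insert hx, Finset.sum_insert hx, ih,
      Finset.erase_insert hx, h1]
    linear_combination h0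

theorem Matrix.det_add_of_mul_eq_zero {ι R : Type*} [Fintype ι] [DecidableEq ι] [CommRing R]
    (A N : Matrix ι ι R) (hN : ∀ i j k l, N i j * N k l = 0) :
    (A + N).det = A.det + (A.adjugate * N).trace := by
  have h (i : ι) : (A.adjugate * N) i i = (A.updateCol i fun k => N k i).det := by
    rw [← Matrix.cramer_apply, Matrix.cramer_eq_adjugate_mulVec]
    rfl
  simp only [Matrix.trace, Matrix.diag_apply, h, Matrix.det_apply']
  rw [Finset.sum_comm, ← Finset.sum_add_distrib]
  refine Finset.sum_congr rfl fun σ _ => ?_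
  simp only [Matrix.add_apply]
  rw [Finset.prod_add_of_mul_eq_zero _ _ _ fun i j => hN _ _ _ _, mul_add, Finset.mul_sum]
  congr 1
  refine Finset.sum_congr rfl fun i _ => ?_
  rw [← Finset.mul_prod_erase _ _ (Finset.mem_univ i), Matrix.updateCol_self]
  congr 2
  refine Finset.prod_congr rfl fun j hj => ?_
  rw [Matrix.updateCol_ne (Finset.ne_of_mem_erase hj)]

theorem det_lowerToeplitz {R : Type*} [CommRing R] (n : ℕ) (Y : ℕ → R) :
    (lowerToeplitz n Y).det = Y 1 ^ n := by
  rw [Matrix.det_of_isLowerTriangular]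
  · simp [lowerToeplitz]
  · intro i j hij
    have : i < j := hij
    simp [lowerToeplitz, this]

theorem lowerToeplitz_map {R S : Type*} [CommRing R] [CommRing S] (f : R →+* S) (n : ℕ)
    (Y : ℕ → R) : (lowerToeplitz n Y).map f = lowerToeplitz n fun k => f (Y k) := by
  ext i j
  simp only [lowerToeplitz, Matrix.map_apply, Matrix.of_apply]
  split_ifs <;> simp

/-- The first column of the adjugate of `lowerToeplitz n Y`, indexed from one and extended
by zero. -/
def adjugateColumn {R : Type*} [CommRing R] (n : ℕ) (Y : ℕ → R) (k : ℕ) : R :=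
  if h : k - 1 < n then (lowerToeplitz n Y).adjugate ⟨k - 1, h⟩ ⟨0, by omega⟩ else 0

theorem map_adjugateColumn {R S : Type*} [CommRing R] [CommRing S] (f : R →+* S) (n : ℕ)
    (Y : ℕ → R) (k : ℕ) :
    f (adjugateColumn n Y k) = adjugateColumn n (fun k => f (Y k)) k := by
  unfold adjugateColumn
  split_ifs with h
  · rw [← lowerToeplitz_map, ← RingHom.mapMatrix_apply, ← RingHom.map_adjugate]
    rfl
  · exact map_zero f

theorem sum_mul_adjugateColumn {R : Type*} [CommRing R] {n p : ℕ} (hp : p < n) (Y : ℕ → R) :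
    ∑ t ∈ Finset.range (p + 1), Y (p - t + 1) * adjugateColumn n Y (t + 1)
      = if p = 0 then Y 1 ^ n else 0 := by
  have h := congrFun (congrFun (Matrix.mul_adjugate (lowerToeplitz n Y)) ⟨p, hp⟩) ⟨0, by omega⟩
  rw [det_lowerToeplitz, Matrix.mul_apply] at h
  have h' : ∀ j : Fin n, lowerToeplitz n Y ⟨p, hp⟩ j * (lowerToeplitz n Y).adjugate j ⟨0, by omega⟩
      = (fun t : ℕ => if t ≤ p then Y (p - t + 1) * adjugateColumn n Y (t + 1) else 0) j := by
    intro j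
    have hj : adjugateColumn n Y (j + 1) = (lowerToeplitz n Y).adjugate j ⟨0, by omega⟩ := by
      simp [adjugateColumn]
    simp only [hj]
    simp only [lowerToeplitz, Matrix.of_apply, ite_mul, zero_mul]
  rw [Finset.sum_congr rfl fun j _ => h' j,
    Fin.sum_univ_eq_sum_range (fun t : ℕ =>
      if t ≤ p then Y (p - t + 1) * adjugateColumn n Y (t + 1) else 0), ← Finset.sum_filter] at h
  have hs : (Finset.range n).filter (fun t => t ≤ p) = Finset.range (p + 1) := by
    ext t
    simp only [Finset.mem_filter, Finset.mem_range]
    omega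
  rw [← hs, h]
  simp [Matrix.one_apply]

theorem lowerToeplitz_mul_apply {R : Type*} [CommRing R] (m : ℕ) (Y Z : ℕ → R) (l i : Fin m) :
    (lowerToeplitz m Y * lowerToeplitz m Z) l i
      = if (i : ℕ) ≤ l then
          ∑ t ∈ Finset.range ((l : ℕ) - i + 1), Y ((l : ℕ) - i - t + 1) * Z (t + 1)
        else 0 := by
  have h : ∀ j : Fin m, lowerToeplitz m Y l j * lowerToeplitz m Z j i
      = (fun t : ℕ => if (i : ℕ) ≤ t ∧ t < (l : ℕ) + 1 then
          Y ((l : ℕ) - t + 1) * Z (t - i + 1) else 0) j := by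
    intro j
    simp only [lowerToeplitz, Matrix.of_apply]
    split_ifs <;> first | omega | simp
  have hs : (Finset.range m).filter (fun t => (i : ℕ) ≤ t ∧ t < (l : ℕ) + 1)
      = Finset.Ico (i : ℕ) (l + 1) := by
    ext t
    simp only [Finset.mem_filter, Finset.mem_range, Finset.mem_Ico]
    omega
  rw [Matrix.mul_apply, Finset.sum_congr rfl fun j _ => h j,
    Fin.sum_univ_eq_sum_range (fun t : ℕ => if (i : ℕ) ≤ t ∧ t < (l : ℕ) + 1 then
          Y ((l : ℕ) - t + 1) * Z (t - i + 1) else 0), ← Finset.sum_filter, hs]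
  split_ifs with hil
  · rw [Finset.sum_Ico_eq_sum_range, show (l : ℕ) + 1 - i = l - i + 1 by omega]
    refine Finset.sum_congr rfl fun t _ => ?_
    rw [Nat.sub_sub, Nat.add_sub_cancel_left]
  · rw [Finset.Ico_eq_empty (by omega), Finset.sum_empty]

theorem lowerToeplitz_mul_adjugateColumn {R : Type*} [CommRing R] {m n : ℕ} (hmn : m ≤ n)
    (Y : ℕ → R) :
    lowerToeplitz m Y * lowerToeplitz m (adjugateColumn n Y) = Y 1 ^ n • 1 := by
  ext l i
  rw [lowerToeplitz_mul_apply, sum_mul_adjugateColumn (by omega)]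
  simp only [Matrix.smul_apply, Matrix.one_apply, smul_eq_mul, mul_ite, mul_one, mul_zero,
    Fin.ext_iff]
  split_ifs <;> first | omega | rfl

theorem Matrix.eq_adjugate_of_mul_eq_smul_one {ι R : Type*} [Fintype ι] [DecidableEq ι]
    [CommRing R] {A B : Matrix ι ι R} (hA : IsLeftRegular A.det) (h : A * B = A.det • 1) :
    A.adjugate = B := by
  have h' : A.det • A.adjugate = A.det • B := by
    rw [← Matrix.mul_one (A.adjugate), ← Matrix.mul_smul, ← h, ← Matrix.mul_assoc,
      Matrix.adjugate_mul, Matrix.smul_mul, Matrix.one_mul]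
  ext i j
  exact hA (congrFun (congrFun h' i) j)

theorem det_fromBlocks_lowerToeplitz {R : Type*} [CommRing R] (m₁ m₂ : ℕ) (Y : ℕ → R) :
    (Matrix.fromBlocks (lowerToeplitz m₁ Y) 0 0 (lowerToeplitz m₂ Y)).det = Y 1 ^ (m₁ + m₂) := by
  rw [Matrix.det_fromBlocks_zero₂₁, det_lowerToeplitz, det_lowerToeplitz, pow_add]

theorem adjugate_fromBlocks_lowerToeplitz_of_isLeftRegular {R : Type*} [CommRing R] (m₁ m₂ : ℕ)
    (Y : ℕ → R) (hY : IsLeftRegular (Y 1)) :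
    (Matrix.fromBlocks (lowerToeplitz m₁ Y) 0 0 (lowerToeplitz m₂ Y)).adjugate
      = Matrix.fromBlocks (lowerToeplitz m₁ (adjugateColumn (m₁ + m₂) Y)) 0 0
          (lowerToeplitz m₂ (adjugateColumn (m₁ + m₂) Y)) := by
  apply Matrix.eq_adjugate_of_mul_eq_smul_one
  · rw [det_fromBlocks_lowerToeplitz]
    exact hY.pow _
  · rw [det_fromBlocks_lowerToeplitz, Matrix.fromBlocks_multiply,
      lowerToeplitz_mul_adjugateColumn (by omega), lowerToeplitz_mul_adjugateColumn (by omega),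
      ← Matrix.fromBlocks_one, Matrix.fromBlocks_smul]
    simp

/-- The regularity hypothesis is removed by replacing `Y 1` with the monic polynomial
`X + C (Y 1)` and evaluating at `0`. -/
theorem adjugate_fromBlocks_lowerToeplitz {R : Type*} [CommRing R] (m₁ m₂ : ℕ) (Y : ℕ → R) :
    (Matrix.fromBlocks (lowerToeplitz m₁ Y) 0 0 (lowerToeplitz m₂ Y)).adjugate
      = Matrix.fromBlocks (lowerToeplitz m₁ (adjugateColumn (m₁ + m₂) Y)) 0 0
          (lowerToeplitz m₂ (adjugateColumn (m₁ + m₂) Y)) := by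
  let P : ℕ → Polynomial R := fun k => (if k = 1 then Polynomial.X else 0) + Polynomial.C (Y k)
  have hP : IsLeftRegular (P 1) := by
    simpa [P] using (Polynomial.monic_X_add_C (Y 1)).isRegular.left
  let f : Polynomial R →+* R := Polynomial.evalRingHom 0
  have hf : (fun k => f (P k)) = Y := by
    funext k
    simp only [P, f, Polynomial.coe_evalRingHom, Polynomial.eval_add, Polynomial.eval_C]
    split_ifs <;> simp
  have h := congrArg f.mapMatrix (adjugate_fromBlocks_lowerToeplitz_of_isLeftRegular m₁ m₂ P hP)
  rw [RingHom.map_adjugate] at h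
  simpa only [RingHom.mapMatrix_apply, Matrix.fromBlocks_map, lowerToeplitz_map,
    map_adjugateColumn, hf, Matrix.map_zero f (map_zero f)] using h

theorem trace_lowerToeplitz_mul {R : Type*} [CommRing R] {m n : ℕ} (hmn : m ≤ n) (Z : ℕ → R)
    (N : Matrix (Fin m) (Fin m) R) :
    (lowerToeplitz m Z * N).trace = ∑ k : Fin n, trSuper N k * Z (k + 1) := by
  simp only [Matrix.trace, Matrix.diag_apply, Matrix.mul_apply, trSuper, Finset.sum_mul]
  rw [Finset.sum_comm, Finset.sum_comm (s := (Finset.univ : Finset (Fin n)))]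
  refine Finset.sum_congr rfl fun i _ => ?_
  let g : ℕ → R := fun j => if h : j < m then N i ⟨j, h⟩ else 0
  have hL : ∀ j : Fin m, lowerToeplitz m Z j i * N i j
      = (fun t : ℕ => if (i : ℕ) ≤ t then Z (t - i + 1) * g t else 0) j := by
    intro j
    simp [lowerToeplitz, g]
  have hs : (Finset.range m).filter (fun t => (i : ℕ) ≤ t) = Finset.Ico (i : ℕ) m := by
    ext t
    simp only [Finset.mem_filter, Finset.mem_range, Finset.mem_Ico]
    omega
  rw [Finset.sum_congr rfl fun j _ => hL j,
    Fin.sum_univ_eq_sum_range (fun t : ℕ => if (i : ℕ) ≤ t then Z (t - i + 1) * g t else 0),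
    ← Finset.sum_filter, hs, Finset.sum_Ico_eq_sum_range]
  refine Eq.trans ?_ (Fin.sum_univ_eq_sum_range (fun k => g (i + k) * Z (k + 1)) n).symm
  rw [← Finset.sum_subset (Finset.range_mono (show m - (i : ℕ) ≤ n by omega))]
  · refine Finset.sum_congr rfl fun t _ => ?_
    rw [Nat.add_sub_cancel_left, mul_comm]
  · intro t _ ht
    rw [Finset.mem_range] at ht
    have : ¬ (i : ℕ) + t < m := by omega
    simp [g, this]

/-- Lemma 2.16(2): with `U' = diag(U_{m₁}(Y), U_{m₂}(Y))` block diagonal and `N'` a matrix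
all of whose products of two entries vanish, with diagonal blocks `N₁₁`, `N₂₂`,
`det (U' + N') = Y_1 ^ n + ∑_{k=1}^n (Tr_{k-1} N₁₁ + Tr_{k-1} N₂₂) · C_{1,k}(U_n)`,
where `n = m₁ + m₂` and the cofactors are taken in the full Toeplitz matrix `U_n`. -/
theorem det_blockDiagonal_lowerToeplitz_add {R : Type*} [CommRing R]
    (m₁ m₂ : ℕ) (h₁ : 0 < m₁) (h₂ : 0 < m₂) (Y : ℕ → R)
    (N' : Matrix (Fin m₁ ⊕ Fin m₂) (Fin m₁ ⊕ Fin m₂) R)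
    (hN : ∀ i j k l, N' i j * N' k l = 0) :
    (Matrix.fromBlocks (lowerToeplitz m₁ Y) 0 0 (lowerToeplitz m₂ Y) + N').det
      = Y 1 ^ (m₁ + m₂) + ∑ k : Fin (m₁ + m₂),
          (trSuper (Matrix.of fun i j => N' (Sum.inl i) (Sum.inl j)) (k : ℕ)
            + trSuper (Matrix.of fun i j => N' (Sum.inr i) (Sum.inr j)) (k : ℕ))
          * (lowerToeplitz (m₁ + m₂) Y).adjugate k ⟨0, by omega⟩ := by
  rw [Matrix.det_add_of_mul_eq_zero _ _ hN, det_fromBlocks_lowerToeplitz,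
    adjugate_fromBlocks_lowerToeplitz]
  congr 1
  have hZ : ∀ k : Fin (m₁ + m₂), (lowerToeplitz (m₁ + m₂) Y).adjugate k ⟨0, by omega⟩
      = adjugateColumn (m₁ + m₂) Y (k + 1) := by
    intro k
    simp [adjugateColumn]
  simp only [hZ, add_mul, Finset.sum_add_distrib]
  rw [← trace_lowerToeplitz_mul (by omega), ← trace_lowerToeplitz_mul (by omega)]
  conv_lhs => rw [← Matrix.fromBlocks_toBlocks N', Matrix.fromBlocks_multiply,
    Matrix.trace, Fintype.sum_sum_type]
  simp only [Matrix.zero_mul, add_zero, zero_add]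
  rfl
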